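/- arXiv:gr-qc/9610042 — 5 statements merged into one kernel-verified Lean document; each statement's English description precedes it below -/
import Mathlib

section
/- Let H = (1/4)π_f² − 1 − (τ²/f²)(π_τ² + π_ω²), J⁰ = −τπ_τ − ωπ_ω, J⁺ = π_ω, and J⁻ = τ²π_ω − 2ωτπ_τ − ω²π_ω be smooth functions on the open subset {f ≠ 0} of the phase space ℝ⁶. Then the Poisson brackets {H, J⁰}, {H, J⁺}, and {H, J⁻} all vanish identically on {f ≠ 0}; i.e. the three current components are observables for the Hamiltonian constraint. -/
noncomputable section

/-- Partial derivative in the 1st coordinate (f). -/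
def d1 (F : ℝ → ℝ → ℝ → ℝ → ℝ → ℝ → ℝ) (f τ ω pf pτ pω : ℝ) : ℝ :=
  deriv (fun x => F x τ ω pf pτ pω) f

/-- Partial derivative in the 2nd coordinate (τ). -/
def d2 (F : ℝ → ℝ → ℝ → ℝ → ℝ → ℝ → ℝ) (f τ ω pf pτ pω : ℝ) : ℝ :=
  deriv (fun x => F f x ω pf pτ pω) τ

/-- Partial derivative in the 3rd coordinate (ω). -/
def d3 (F : ℝ → ℝ → ℝ → ℝ → ℝ → ℝ → ℝ) (f τ ω pf pτ pω : ℝ) : ℝ :=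
  deriv (fun x => F f τ x pf pτ pω) ω

/-- Partial derivative in the 4th coordinate (π_f). -/
def d4 (F : ℝ → ℝ → ℝ → ℝ → ℝ → ℝ → ℝ) (f τ ω pf pτ pω : ℝ) : ℝ :=
  deriv (fun x => F f τ ω x pτ pω) pf

/-- Partial derivative in the 5th coordinate (π_τ). -/
def d5 (F : ℝ → ℝ → ℝ → ℝ → ℝ → ℝ → ℝ) (f τ ω pf pτ pω : ℝ) : ℝ :=
  deriv (fun x => F f τ ω pf x pω) pτ

/-- Partial derivative in the 6th coordinate (π_ω). -/
def d6 (F : ℝ → ℝ → ℝ → ℝ → ℝ → ℝ → ℝ) (f τ ω pf pτ pω : ℝ) : ℝ :=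
  deriv (fun x => F f τ ω pf pτ x) pω

/-- Canonical Poisson bracket on the phase space ℝ⁶ with coordinates
(f, τ, ω, π_f, π_τ, π_ω). -/
def poissonBracket (F G : ℝ → ℝ → ℝ → ℝ → ℝ → ℝ → ℝ) (f τ ω pf pτ pω : ℝ) : ℝ :=
  d1 F f τ ω pf pτ pω * d4 G f τ ω pf pτ pω +
  d2 F f τ ω pf pτ pω * d5 G f τ ω pf pτ pω +
  d3 F f τ ω pf pτ pω * d6 G f τ ω pf pτ pω -
  d4 F f τ ω pf pτ pω * d1 G f τ ω pf pτ pω -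
  d5 F f τ ω pf pτ pω * d2 G f τ ω pf pτ pω -
  d6 F f τ ω pf pτ pω * d3 G f τ ω pf pτ pω

/-- The Hamiltonian constraint H = (1/4)π_f² − 1 − (τ²/f²)(π_τ² + π_ω²). -/
def Ham : ℝ → ℝ → ℝ → ℝ → ℝ → ℝ → ℝ :=
  fun f τ _ω pf pτ pω => (1/4) * pf^2 - 1 - (τ^2 / f^2) * (pτ^2 + pω^2)

/-- The current component J⁰ = −τπ_τ − ωπ_ω. -/
def J0 : ℝ → ℝ → ℝ → ℝ → ℝ → ℝ → ℝ :=
  fun _f τ ω _pf pτ pω => -τ * pτ - ω * pω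

/-- The current component J⁺ = π_ω. -/
def Jp : ℝ → ℝ → ℝ → ℝ → ℝ → ℝ → ℝ :=
  fun _f _τ _ω _pf _pτ pω => pω

/-- The current component J⁻ = τ²π_ω − 2ωτπ_τ − ω²π_ω. -/
def Jm : ℝ → ℝ → ℝ → ℝ → ℝ → ℝ → ℝ :=
  fun _f τ ω _pf pτ pω => τ^2 * pω - 2 * ω * τ * pτ - ω^2 * pω

theorem d2_Ham (f τ ω pf pτ pω : ℝ) :
    d2 Ham f τ ω pf pτ pω = -(2 * τ / f^2 * (pτ^2 + pω^2)) := by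
  simp [d2, Ham]

theorem d3_Ham (f τ ω pf pτ pω : ℝ) : d3 Ham f τ ω pf pτ pω = 0 := by
  simp [d3, Ham]

theorem d5_Ham (f τ ω pf pτ pω : ℝ) :
    d5 Ham f τ ω pf pτ pω = -(τ^2 / f^2 * (2 * pτ)) := by
  simp [d5, Ham]

theorem d6_Ham (f τ ω pf pτ pω : ℝ) :
    d6 Ham f τ ω pf pτ pω = -(τ^2 / f^2 * (2 * pω)) := by
  simp [d6, Ham]

/-- The bracket of `Ham` with a function independent of `f` and `π_f`. -/
theorem poissonBracket_Ham {G : ℝ → ℝ → ℝ → ℝ → ℝ → ℝ → ℝ} {f τ ω pf pτ pω a b c : ℝ}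
    (h1 : d1 G f τ ω pf pτ pω = 0) (h4 : d4 G f τ ω pf pτ pω = 0)
    (h5 : d5 G f τ ω pf pτ pω = a) (h2 : d2 G f τ ω pf pτ pω = b)
    (h3 : d3 G f τ ω pf pτ pω = c) :
    poissonBracket Ham G f τ ω pf pτ pω =
      2 * τ / f^2 * (τ * (pτ * b + pω * c) - (pτ^2 + pω^2) * a) := by
  rw [poissonBracket, d2_Ham, d3_Ham, d5_Ham, d6_Ham, h1, h2, h3, h4, h5]
  ring

/-- The Poisson brackets of the Hamiltonian constraint with the three
current components vanish identically on the open set {f ≠ 0}. -/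
theorem poissonBracket_Ham_currents_eq_zero :
    ∀ f τ ω pf pτ pω : ℝ, f ≠ 0 →
      poissonBracket Ham J0 f τ ω pf pτ pω = 0 ∧
      poissonBracket Ham Jp f τ ω pf pτ pω = 0 ∧
      poissonBracket Ham Jm f τ ω pf pτ pω = 0 := by
  intro f τ ω pf pτ pω _
  refine ⟨?_, ?_, ?_⟩
  · rw [poissonBracket_Ham (G := J0) (a := -τ) (b := -pτ) (c := -pω)]
    · ring
    · simp [d1, J0]
    · simp [d4, J0]
    · simp [d5, J0]
    · simp [d2, J0]
    · simp [d3, J0]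
  · rw [poissonBracket_Ham (G := Jp) (a := 0) (b := 0) (c := 0)]
    · ring
    all_goals simp [d1, d2, d3, d4, d5, Jp]
  · rw [poissonBracket_Ham (G := Jm) (a := -(2 * ω * τ)) (b := 2 * τ * pω - 2 * ω * pτ)
      (c := -(2 * τ * pτ) - 2 * ω * pω)]
    · ring
    · simp [d1, Jm]
    · simp [d4, Jm]
    · simp [d5, Jm]
    · have h := ((((hasDerivAt_id τ).pow 2).mul_const pω).sub
        (((hasDerivAt_id τ).const_mul (2 * ω)).mul_const pτ)).sub_const (ω^2 * pω)
      simpa [d2, Jm] using h.deriv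
    · have h := (((((hasDerivAt_id ω).const_mul 2).mul_const τ).mul_const pτ).const_sub
        (τ^2 * pω)).sub (((hasDerivAt_id ω).pow 2).mul_const pω)
      simpa [d3, Jm, Pi.sub_def] using h.deriv
end
end

section
/- Define on phase space the Casimir function TrJ² = 2(J⁰)² + 2J⁺J⁻, where J⁰ = −τπ_τ − ωπ_ω, J⁺ = π_ω, J⁻ = τ²π_ω − 2ωτπ_τ − ω²π_ω, and let H = (1/4)π_f² − 1 − (τ²/f²)(π_τ² + π_ω²). Then the Poisson brackets {TrJ², J⁰}, {TrJ², J⁺}, {TrJ², J⁻} vanish identically on ℝ⁶, and {TrJ², H} vanishes on the open set {f ≠ 0}. -/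
noncomputable section

/-- The Casimir function TrJ² = 2(J⁰)² + 2J⁺J⁻. -/
def TrJsq : ℝ → ℝ → ℝ → ℝ → ℝ → ℝ → ℝ :=
  fun f τ ω pf pτ pω =>
    2 * (J0 f τ ω pf pτ pω)^2 + 2 * Jp f τ ω pf pτ pω * Jm f τ ω pf pτ pω

lemma TrJsq_eq :
    TrJsq = fun _f τ _ω _pf pτ pω => 2 * τ ^ 2 * (pτ ^ 2 + pω ^ 2) := by
  funext f τ ω pf pτ pω
  simp only [TrJsq, J0, Jp, Jm]
  ring

lemma deriv_quadratic {g : ℝ → ℝ} (a b c y : ℝ) (h : ∀ x, g x = a * x ^ 2 + b * x + c) :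
    deriv g y = 2 * a * y + b := by
  rw [funext h]
  have := (((hasDerivAt_pow 2 y).const_mul a).add ((hasDerivAt_id y).const_mul b)).add_const c
  refine (this.congr_deriv ?_).deriv
  norm_num
  ring

/-- The bracket with the Casimir involves no `f`- or `ω`-derivatives of the Casimir. -/
lemma poissonBracket_TrJsq_left (G : ℝ → ℝ → ℝ → ℝ → ℝ → ℝ → ℝ) (f τ ω pf pτ pω : ℝ) :
    poissonBracket TrJsq G f τ ω pf pτ pω =
      4 * τ * (pτ ^ 2 + pω ^ 2) * d5 G f τ ω pf pτ pω -
      4 * τ ^ 2 * pτ * d2 G f τ ω pf pτ pω - 4 * τ ^ 2 * pω * d3 G f τ ω pf pτ pω := by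
  have h1 : d1 TrJsq f τ ω pf pτ pω = 0 := by simp [d1, TrJsq_eq]
  have h2 : d2 TrJsq f τ ω pf pτ pω = 2 * (2 * (pτ ^ 2 + pω ^ 2)) * τ + 0 :=
    deriv_quadratic _ 0 0 τ fun x => by rw [TrJsq_eq]; ring
  have h3 : d3 TrJsq f τ ω pf pτ pω = 0 := by simp [d3, TrJsq_eq]
  have h4 : d4 TrJsq f τ ω pf pτ pω = 0 := by simp [d4, TrJsq_eq]
  have h5 : d5 TrJsq f τ ω pf pτ pω = 2 * (2 * τ ^ 2) * pτ + 0 :=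
    deriv_quadratic _ 0 (2 * τ ^ 2 * pω ^ 2) pτ fun x => by rw [TrJsq_eq]; ring
  have h6 : d6 TrJsq f τ ω pf pτ pω = 2 * (2 * τ ^ 2) * pω + 0 :=
    deriv_quadratic _ 0 (2 * τ ^ 2 * pτ ^ 2) pω fun x => by rw [TrJsq_eq]; ring
  rw [poissonBracket, h1, h2, h3, h4, h5, h6]
  ring

/-- The Casimir TrJ² Poisson-commutes with all three currents identically on ℝ⁶,
and with the Hamiltonian constraint on the open set {f ≠ 0}. -/
theorem poissonBracket_TrJsq :
    (∀ f τ ω pf pτ pω : ℝ,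
      poissonBracket TrJsq J0 f τ ω pf pτ pω = 0 ∧
      poissonBracket TrJsq Jp f τ ω pf pτ pω = 0 ∧
      poissonBracket TrJsq Jm f τ ω pf pτ pω = 0) ∧
    (∀ f τ ω pf pτ pω : ℝ, f ≠ 0 →
      poissonBracket TrJsq Ham f τ ω pf pτ pω = 0) := by
  refine ⟨fun f τ ω pf pτ pω => ⟨?_, ?_, ?_⟩, fun f τ ω pf pτ pω _ => ?_⟩ <;>
    rw [poissonBracket_TrJsq_left]
  · have h2 : d2 J0 f τ ω pf pτ pω = 2 * 0 * τ + -pτ :=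
      deriv_quadratic 0 (-pτ) (-ω * pω) τ fun x => by rw [J0]; ring
    have h3 : d3 J0 f τ ω pf pτ pω = 2 * 0 * ω + -pω :=
      deriv_quadratic 0 (-pω) (-τ * pτ) ω fun x => by rw [J0]; ring
    have h5 : d5 J0 f τ ω pf pτ pω = 2 * 0 * pτ + -τ :=
      deriv_quadratic 0 (-τ) (-ω * pω) pτ fun x => by rw [J0]; ring
    rw [h2, h3, h5]
    ring
  · simp [d2, d3, d5, Jp]
  · have h2 : d2 Jm f τ ω pf pτ pω = 2 * pω * τ + -2 * ω * pτ :=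
      deriv_quadratic pω (-2 * ω * pτ) (-ω ^ 2 * pω) τ fun x => by rw [Jm]; ring
    have h3 : d3 Jm f τ ω pf pτ pω = 2 * -pω * ω + -2 * τ * pτ :=
      deriv_quadratic (-pω) (-2 * τ * pτ) (τ ^ 2 * pω) ω fun x => by rw [Jm]; ring
    have h5 : d5 Jm f τ ω pf pτ pω = 2 * 0 * pτ + -2 * ω * τ :=
      deriv_quadratic 0 (-2 * ω * τ) (τ ^ 2 * pω - ω ^ 2 * pω) pτ fun x => by rw [Jm]; ring
    rw [h2, h3, h5]
    ring
  · have h2 : d2 Ham f τ ω pf pτ pω = 2 * (-(pτ ^ 2 + pω ^ 2) / f ^ 2) * τ + 0 :=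
      deriv_quadratic _ 0 (1 / 4 * pf ^ 2 - 1) τ fun x => by rw [Ham]; ring
    have h3 : d3 Ham f τ ω pf pτ pω = 0 := by simp [d3, Ham]
    have h5 : d5 Ham f τ ω pf pτ pω = 2 * (-τ ^ 2 / f ^ 2) * pτ + 0 :=
      deriv_quadratic _ 0 (1 / 4 * pf ^ 2 - 1 - τ ^ 2 / f ^ 2 * pω ^ 2) pτ fun x => by
        rw [Ham]; ring
    rw [h2, h3, h5]
    ring
end
end

section
/- Let Ĵ⁰, Ĵ⁺, Ĵ⁻ be the differential operators on smooth complex-valued functions ψ(ω, τ) on ℝ × (0, ∞) given by Ĵ⁰ψ = −i(τ ∂_τψ + ω ∂_ωψ), Ĵ⁺ψ = i ∂_ωψ, Ĵ⁻ψ = i(τ² − ω²) ∂_ωψ − 2iωτ ∂_τψ. Then for every smooth ψ the commutators satisfy [Ĵ⁺, Ĵ⁰]ψ = −i Ĵ⁺ψ, [Ĵ⁺, Ĵ⁻]ψ = 2i Ĵ⁰ψ, and [Ĵ⁰, Ĵ⁻]ψ = −i Ĵ⁻ψ, i.e. the current operators form an sl(2,ℝ) algebra. -/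
noncomputable section

open Complex

/-- Partial derivative with respect to ω. -/
def pOm (ψ : ℝ → ℝ → ℂ) : ℝ → ℝ → ℂ := fun ω τ => deriv (fun x => ψ x τ) ω

/-- Partial derivative with respect to τ. -/
def pTa (ψ : ℝ → ℝ → ℂ) : ℝ → ℝ → ℂ := fun ω τ => deriv (fun t => ψ ω t) τ

/-- The Schwarzschild mass operator Ĵ⁰ψ = −i(τ ∂_τψ + ω ∂_ωψ). -/
def J0op (ψ : ℝ → ℝ → ℂ) : ℝ → ℝ → ℂ :=
  fun ω τ => -I * ((τ : ℂ) * pTa ψ ω τ + (ω : ℂ) * pOm ψ ω τ)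

/-- The Taub-NUT charge operator Ĵ⁺ψ = i ∂_ωψ. -/
def Jpop (ψ : ℝ → ℝ → ℂ) : ℝ → ℝ → ℂ :=
  fun ω τ => I * pOm ψ ω τ

/-- The operator Ĵ⁻ψ = i(τ² − ω²) ∂_ωψ − 2iωτ ∂_τψ. -/
def Jmop (ψ : ℝ → ℝ → ℂ) : ℝ → ℝ → ℂ :=
  fun ω τ => I * ((τ : ℂ)^2 - (ω : ℂ)^2) * pOm ψ ω τ - 2 * I * (ω : ℂ) * (τ : ℂ) * pTa ψ ω τ

/-- Smoothness on the half-plane `ℝ × (0, ∞)`. -/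
def SmoothOnHalfPlane (ψ : ℝ → ℝ → ℂ) : Prop :=
  ContDiffOn ℝ (⊤ : ℕ∞) (fun p : ℝ × ℝ => ψ p.1 p.2) (Set.univ ×ˢ Set.Ioi (0 : ℝ))

lemma isOpen_halfPlane : IsOpen ((Set.univ : Set ℝ) ×ˢ Set.Ioi (0 : ℝ)) :=
  isOpen_univ.prod isOpen_Ioi

namespace SmoothOnHalfPlane

variable {ψ : ℝ → ℝ → ℂ} {ω τ : ℝ}

lemma contDiffAt (h : SmoothOnHalfPlane ψ) (hτ : 0 < τ) :
    ContDiffAt ℝ (⊤ : ℕ∞) (fun p : ℝ × ℝ => ψ p.1 p.2) (ω, τ) :=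
  ContDiffOn.contDiffAt h (isOpen_halfPlane.mem_nhds ⟨Set.mem_univ _, hτ⟩)

lemma hasFDerivAt (h : SmoothOnHalfPlane ψ) (hτ : 0 < τ) :
    HasFDerivAt (fun p : ℝ × ℝ => ψ p.1 p.2)
      (fderiv ℝ (fun p : ℝ × ℝ => ψ p.1 p.2) (ω, τ)) (ω, τ) :=
  ((h.contDiffAt hτ).differentiableAt (by simp)).hasFDerivAt

lemma hasDerivAt_fst_fderiv (h : SmoothOnHalfPlane ψ) (hτ : 0 < τ) :
    HasDerivAt (fun x => ψ x τ) (fderiv ℝ (fun p : ℝ × ℝ => ψ p.1 p.2) (ω, τ) (1, 0)) ω :=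
  (h.hasFDerivAt hτ).comp_hasDerivAt (f := fun x : ℝ => (x, τ)) ω
    ((hasDerivAt_id ω).prodMk (hasDerivAt_const ω τ))

lemma hasDerivAt_snd_fderiv (h : SmoothOnHalfPlane ψ) (hτ : 0 < τ) :
    HasDerivAt (fun t => ψ ω t) (fderiv ℝ (fun p : ℝ × ℝ => ψ p.1 p.2) (ω, τ) (0, 1)) τ :=
  (h.hasFDerivAt hτ).comp_hasDerivAt (f := fun t : ℝ => (ω, t)) τ
    ((hasDerivAt_const τ ω).prodMk (hasDerivAt_id τ))

lemma pOm_eq (h : SmoothOnHalfPlane ψ) (hτ : 0 < τ) :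
    pOm ψ ω τ = fderiv ℝ (fun p : ℝ × ℝ => ψ p.1 p.2) (ω, τ) (1, 0) :=
  (h.hasDerivAt_fst_fderiv hτ).deriv

lemma pTa_eq (h : SmoothOnHalfPlane ψ) (hτ : 0 < τ) :
    pTa ψ ω τ = fderiv ℝ (fun p : ℝ × ℝ => ψ p.1 p.2) (ω, τ) (0, 1) :=
  (h.hasDerivAt_snd_fderiv hτ).deriv

lemma hasDerivAt_fst (h : SmoothOnHalfPlane ψ) (hτ : 0 < τ) :
    HasDerivAt (fun x => ψ x τ) (pOm ψ ω τ) ω :=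
  (h.hasDerivAt_fst_fderiv hτ).differentiableAt.hasDerivAt

lemma hasDerivAt_snd (h : SmoothOnHalfPlane ψ) (hτ : 0 < τ) :
    HasDerivAt (fun t => ψ ω t) (pTa ψ ω τ) τ :=
  (h.hasDerivAt_snd_fderiv hτ).differentiableAt.hasDerivAt

lemma contDiffOn_fderiv (h : SmoothOnHalfPlane ψ) :
    ContDiffOn ℝ (⊤ : ℕ∞) (fderiv ℝ (fun p : ℝ × ℝ => ψ p.1 p.2))
      (Set.univ ×ˢ Set.Ioi (0 : ℝ)) :=
  ContDiffOn.fderiv_of_isOpen h isOpen_halfPlane (by simp)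

protected lemma pOm (h : SmoothOnHalfPlane ψ) : SmoothOnHalfPlane (pOm ψ) :=
  (h.contDiffOn_fderiv.clm_apply contDiffOn_const).congr fun _ hp => h.pOm_eq hp.2

protected lemma pTa (h : SmoothOnHalfPlane ψ) : SmoothOnHalfPlane (pTa ψ) :=
  (h.contDiffOn_fderiv.clm_apply contDiffOn_const).congr fun _ hp => h.pTa_eq hp.2

/-- Mixed partial derivatives agree. -/
lemma pOm_pTa (h : SmoothOnHalfPlane ψ) (hτ : 0 < τ) :
    pOm (pTa ψ) ω τ = pTa (pOm ψ) ω τ := by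
  have hmem : (Set.univ : Set ℝ) ×ˢ Set.Ioi (0 : ℝ) ∈ nhds (ω, τ) :=
    isOpen_halfPlane.mem_nhds ⟨Set.mem_univ _, hτ⟩
  have hd : HasFDerivAt (fderiv ℝ (fun p : ℝ × ℝ => ψ p.1 p.2))
      (fderiv ℝ (fderiv ℝ (fun p : ℝ × ℝ => ψ p.1 p.2)) (ω, τ)) (ω, τ) :=
    ((h.contDiffOn_fderiv.contDiffAt hmem).differentiableAt (by simp)).hasFDerivAt
  have hsymm := ((h.contDiffAt (ω := ω) hτ).isSymmSndFDerivAt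
    (by simpa using WithTop.coe_le_coe.2 (le_top : (2 : ℕ∞) ≤ ⊤))).eq (1, 0) (0, 1)
  have hT : HasFDerivAt (fun p : ℝ × ℝ => pTa ψ p.1 p.2) _ (ω, τ) :=
    (hd.clm_apply (hasFDerivAt_const ((0, 1) : ℝ × ℝ) (ω, τ))).congr_of_eventuallyEq
      (Filter.eventuallyEq_of_mem hmem fun _ hp => h.pTa_eq hp.2)
  have hO : HasFDerivAt (fun p : ℝ × ℝ => pOm ψ p.1 p.2) _ (ω, τ) :=
    (hd.clm_apply (hasFDerivAt_const ((1, 0) : ℝ × ℝ) (ω, τ))).congr_of_eventuallyEq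
      (Filter.eventuallyEq_of_mem hmem fun _ hp => h.pOm_eq hp.2)
  rw [h.pTa.pOm_eq hτ, h.pOm.pTa_eq hτ, hT.fderiv, hO.fderiv]
  simpa using hsymm

lemma pOm_Jpop (h : SmoothOnHalfPlane ψ) (hτ : 0 < τ) :
    pOm (Jpop ψ) ω τ = I * pOm (pOm ψ) ω τ :=
  ((h.pOm.hasDerivAt_fst hτ).const_mul I).deriv

lemma pTa_Jpop (h : SmoothOnHalfPlane ψ) (hτ : 0 < τ) :
    pTa (Jpop ψ) ω τ = I * pTa (pOm ψ) ω τ :=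
  ((h.pOm.hasDerivAt_snd hτ).const_mul I).deriv

lemma pOm_J0op (h : SmoothOnHalfPlane ψ) (hτ : 0 < τ) :
    pOm (J0op ψ) ω τ =
      -I * (τ * pOm (pTa ψ) ω τ + (pOm ψ ω τ + ω * pOm (pOm ψ) ω τ)) := by
  have hω : HasDerivAt (fun x : ℝ => (x : ℂ)) 1 ω := (hasDerivAt_id ω).ofReal_comp
  refine ((((h.pTa.hasDerivAt_fst hτ).const_mul (τ : ℂ)).add
    (hω.mul (h.pOm.hasDerivAt_fst hτ))).const_mul (-I)).deriv.trans ?_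
  ring

lemma pTa_J0op (h : SmoothOnHalfPlane ψ) (hτ : 0 < τ) :
    pTa (J0op ψ) ω τ =
      -I * (pTa ψ ω τ + τ * pTa (pTa ψ) ω τ + ω * pTa (pOm ψ) ω τ) := by
  have ht : HasDerivAt (fun t : ℝ => (t : ℂ)) 1 τ := (hasDerivAt_id τ).ofReal_comp
  refine (((ht.mul (h.pTa.hasDerivAt_snd hτ)).add
    ((h.pOm.hasDerivAt_snd hτ).const_mul (ω : ℂ))).const_mul (-I)).deriv.trans ?_
  ring

lemma pOm_Jmop (h : SmoothOnHalfPlane ψ) (hτ : 0 < τ) :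
    pOm (Jmop ψ) ω τ =
      I * (-2 * ω * pOm ψ ω τ + ((τ : ℂ) ^ 2 - (ω : ℂ) ^ 2) * pOm (pOm ψ) ω τ)
        - 2 * I * τ * (pTa ψ ω τ + ω * pOm (pTa ψ) ω τ) := by
  have hω : HasDerivAt (fun x : ℝ => (x : ℂ)) 1 ω := (hasDerivAt_id ω).ofReal_comp
  refine (((((hω.pow 2).const_sub ((τ : ℂ) ^ 2)).const_mul I).mul
    (h.pOm.hasDerivAt_fst hτ)).sub
    (((hω.const_mul (2 * I)).mul_const (τ : ℂ)).mul (h.pTa.hasDerivAt_fst hτ))).deriv.trans ?_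
  simp
  ring

lemma pTa_Jmop (h : SmoothOnHalfPlane ψ) (hτ : 0 < τ) :
    pTa (Jmop ψ) ω τ =
      I * (2 * τ * pOm ψ ω τ + ((τ : ℂ) ^ 2 - (ω : ℂ) ^ 2) * pTa (pOm ψ) ω τ)
        - 2 * I * ω * (pTa ψ ω τ + τ * pTa (pTa ψ) ω τ) := by
  have ht : HasDerivAt (fun t : ℝ => (t : ℂ)) 1 τ := (hasDerivAt_id τ).ofReal_comp
  refine (((((ht.pow 2).sub_const ((ω : ℂ) ^ 2)).const_mul I).mul
    (h.pOm.hasDerivAt_snd hτ)).sub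
    ((ht.const_mul (2 * I * (ω : ℂ))).mul (h.pTa.hasDerivAt_snd hτ))).deriv.trans ?_
  simp
  ring

end SmoothOnHalfPlane

/-- The current operators Ĵ⁰, Ĵ⁺, Ĵ⁻ form an sl(2,ℝ) algebra:
[Ĵ⁺, Ĵ⁰] = −iĴ⁺, [Ĵ⁺, Ĵ⁻] = 2iĴ⁰, [Ĵ⁰, Ĵ⁻] = −iĴ⁻ on smooth functions on ℝ × (0,∞). -/
theorem currents_operator_sl2R (ψ : ℝ → ℝ → ℂ)
    (hψ : ContDiffOn ℝ (⊤ : ℕ∞) (fun p : ℝ × ℝ => ψ p.1 p.2) (Set.univ ×ˢ Set.Ioi (0 : ℝ))) :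
    ∀ ω τ : ℝ, 0 < τ →
      (Jpop (J0op ψ) ω τ - J0op (Jpop ψ) ω τ = -I * Jpop ψ ω τ) ∧
      (Jpop (Jmop ψ) ω τ - Jmop (Jpop ψ) ω τ = 2 * I * J0op ψ ω τ) ∧
      (J0op (Jmop ψ) ω τ - Jmop (J0op ψ) ω τ = -I * Jmop ψ ω τ) := by
  intro ω τ hτ
  have h : SmoothOnHalfPlane ψ := hψ
  have hJp : Jpop ψ ω τ = I * pOm ψ ω τ := rfl
  refine ⟨?_, ?_, ?_⟩
  · rw [Jpop, J0op, h.pOm_J0op hτ, h.pOm_Jpop hτ, h.pTa_Jpop hτ, h.pOm_pTa hτ, hJp]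
    ring
  · rw [Jpop, Jmop, h.pOm_Jmop hτ, h.pOm_Jpop hτ, h.pTa_Jpop hτ, h.pOm_pTa hτ, J0op]
    ring
  · rw [J0op, Jmop, h.pOm_Jmop hτ, h.pTa_Jmop hτ, h.pOm_J0op hτ, h.pTa_J0op hτ,
      h.pOm_pTa hτ, Jmop]
    ring
end
end

section
/- Let t ∈ ℝ and define the K-Bessel function of purely imaginary order by its integral representation K_{it}(x) = ∫_0^∞ e^{−x cosh u} cos(t u) du for x > 0. Then for every real L ≠ 0 and every integer n > 1, the function ψ(ω, τ) = e^{−iLω} √τ · K_{it}(|L| τ) belongs to L²(H, dμₙ), i.e. ∫_{−∞}^{∞} ∫_0^{∞} τ · K_{it}(|L|τ)² · τ^{n−2} (ω² + (1 + τ)²)^{−n} dτ dω < ∞. -/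
noncomputable section

open MeasureTheory Real

/-- The K-Bessel function of purely imaginary order it, defined by its integral
representation K_{it}(x) = ∫₀^∞ e^{−x cosh u} cos(tu) du for x > 0. -/
def KBessel (t x : ℝ) : ℝ :=
  ∫ u in Set.Ioi (0 : ℝ), Real.exp (-x * Real.cosh u) * Real.cos (t * u)

/-- A Gaussian lower exponent for the hyperbolic cosine on the positive half-line. -/
lemma sq_div_four_le_cosh {u : ℝ} (hu : 0 ≤ u) : u ^ 2 / 4 ≤ Real.cosh u := by
  have h := Real.quadratic_le_exp_of_nonneg hu
  have h' := Real.exp_pos (-u)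
  rw [Real.cosh_eq]
  linarith

/-- The K-Bessel function of imaginary order satisfies `K_{it}(x)² ≤ π / x`. -/
lemma KBessel_sq_le (t : ℝ) {x : ℝ} (hx : 0 < x) : KBessel t x ^ 2 ≤ π / x := by
  have hint : IntegrableOn (fun u : ℝ => Real.exp (-(x / 4) * u ^ 2)) (Set.Ioi 0) :=
    (integrable_exp_neg_mul_sq (by positivity)).integrableOn
  have hle : ‖KBessel t x‖ ≤ ∫ u in Set.Ioi (0 : ℝ), Real.exp (-(x / 4) * u ^ 2) := by
    refine norm_integral_le_of_norm_le hint ?_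
    filter_upwards [ae_restrict_mem measurableSet_Ioi] with u hu
    rw [norm_mul, Real.norm_eq_abs, Real.norm_eq_abs, Real.abs_exp]
    refine (mul_le_of_le_one_right (Real.exp_pos _).le (Real.abs_cos_le_one _)).trans ?_
    have := mul_le_mul_of_nonneg_left (sq_div_four_le_cosh (le_of_lt hu)) hx.le
    exact Real.exp_le_exp.mpr (by linarith)
  rw [integral_gaussian_Ioi, Real.norm_eq_abs] at hle
  calc KBessel t x ^ 2 = |KBessel t x| ^ 2 := (sq_abs _).symm
    _ ≤ (√(π / (x / 4)) / 2) ^ 2 := by gcongr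
    _ = π / x := by
      rw [div_pow, Real.sq_sqrt (by positivity)]
      field_simp
      norm_num

/-- The damped weight is dominated by a product of two Cauchy densities. -/
lemma zpow_div_damping_le (ω : ℝ) {τ : ℝ} (hτ : 0 < τ) {n : ℕ} (hn : 1 < n) :
    τ ^ ((n : ℤ) - 2) / (ω ^ 2 + (1 + τ) ^ 2) ^ n ≤ (1 + ω ^ 2)⁻¹ * (1 + τ ^ 2)⁻¹ := by
  obtain ⟨m, rfl⟩ : ∃ m, n = m + 2 := ⟨n - 2, by omega⟩
  have hz : ((m + 2 : ℕ) : ℤ) - 2 = m := by push_cast; ring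
  rw [hz, zpow_natCast, ← mul_inv, ← one_div, pow_add,
    div_le_div_iff₀ (by positivity) (by positivity), one_mul]
  have h₁ : τ ^ m ≤ (ω ^ 2 + (1 + τ) ^ 2) ^ m := by
    gcongr
    nlinarith [sq_nonneg ω]
  have h₂ : (1 + ω ^ 2) * (1 + τ ^ 2) ≤ (ω ^ 2 + (1 + τ) ^ 2) ^ 2 := by
    rw [sq (ω ^ 2 + (1 + τ) ^ 2)]
    apply mul_le_mul <;> nlinarith [sq_nonneg ω, sq_nonneg τ]
  gcongr

/-- For every t ∈ ℝ, L ≠ 0, and integer n > 1 the function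
ψ(ω, τ) = e^{−iLω}√τ·K_{it}(|L|τ) is square-integrable with respect to the
measure dμₙ = τ^{n−2}(ω² + (1+τ)²)^{−n} dω dτ on the upper half plane:
∫∫ τ·K_{it}(|L|τ)²·τ^{n−2}(ω² + (1+τ)²)^{−n} dτ dω < ∞. -/
theorem KBessel_memL2 (t L : ℝ) (hL : L ≠ 0) (n : ℕ) (hn : 1 < n) :
    (∫⁻ p : ℝ × ℝ in Set.univ ×ˢ Set.Ioi (0 : ℝ),
        ENNReal.ofReal (p.2 * (KBessel t (|L| * p.2)) ^ 2 *
          (p.2 ^ ((n : ℤ) - 2) / (p.1 ^ 2 + (1 + p.2) ^ 2) ^ n))) < ⊤ := by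
  have hL' : 0 < |L| := abs_pos.mpr hL
  have hint : Integrable
      (fun p : ℝ × ℝ => π / |L| * ((1 + p.1 ^ 2)⁻¹ * (1 + p.2 ^ 2)⁻¹)) :=
    (integrable_inv_one_add_sq.mul_prod integrable_inv_one_add_sq).const_mul _
  refine lt_of_le_of_lt ?_ (hint.integrableOn (s := Set.univ ×ˢ Set.Ioi 0)).lintegral_lt_top
  refine setLIntegral_mono' (MeasurableSet.univ.prod measurableSet_Ioi) fun p hp => ?_
  have hp : 0 < p.2 := hp.2
  refine ENNReal.ofReal_le_ofReal (mul_le_mul ?_ (zpow_div_damping_le p.1 hp hn)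
    (by positivity) (by positivity))
  calc p.2 * KBessel t (|L| * p.2) ^ 2 ≤ p.2 * (π / (|L| * p.2)) := by
        gcongr
        exact KBessel_sq_le t (by positivity)
    _ = π / |L| := by field_simp
end
end

section
/- Let n be a positive integer, let C : (0, ∞) → ℂ be measurable, and let ε ∈ {+1, −1}. If the function ψ(ω, τ) = e^{εω} C(τ) is square-integrable with respect to the measure dμₙ = τ^{n−2}(ω² + (1 + τ)²)^{−n} dω dτ on ℝ × (0, ∞), then C = 0 almost everywhere on (0, ∞). (Since e^{∓ω}C(τ) are exactly the formal solutions of the deficiency equations (i ± Ĵ⁺)ψ = 0 with Ĵ⁺ψ = i∂_ωψ, both deficiency indices of the Taub-NUT charge operator Ĵ⁺ are zero.) -/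
noncomputable section

open MeasureTheory

/-- A power of a shifted square is dominated by a multiple of the exponential on the half-line. -/
lemma sq_add_pow_le_mul_exp {n : ℕ} (hn : 0 < n) {a x : ℝ} (ha : 0 ≤ a) (hx : 0 ≤ x) :
    (x ^ 2 + a) ^ n ≤ (n ^ 2 + a) ^ n * Real.exp x ^ 2 := by
  have hn' : (0 : ℝ) < n := Nat.cast_pos.mpr hn
  set E := Real.exp (x / n) with hE
  have hxE : x ≤ n * E := by
    have h1 := Real.add_one_le_exp (x / n)
    have h2 : x / n ≤ E := by linarith
    calc x = n * (x / n) := by field_simp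
      _ ≤ n * E := by gcongr
  have hE1 : 1 ≤ E := Real.one_le_exp (by positivity)
  have hEn : E ^ n = Real.exp x := by
    rw [hE, ← Real.exp_nat_mul]
    congr 1
    field_simp
  calc (x ^ 2 + a) ^ n ≤ ((n * E) ^ 2 + a * E ^ 2) ^ n := by
        gcongr
        exact le_mul_of_one_le_right ha (one_le_pow₀ hE1)
    _ = (n ^ 2 + a) ^ n * (E ^ n) ^ 2 := by
        rw [pow_right_comm E n 2, ← mul_pow]
        ring
    _ = (n ^ 2 + a) ^ n * Real.exp x ^ 2 := by rw [hEn]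

lemma volume_setOf_nonneg_mul {ε : ℝ} (hε : ε = 1 ∨ ε = -1) :
    volume {x : ℝ | 0 ≤ ε * x} = ⊤ := by
  rcases hε with rfl | rfl
  · simpa only [one_mul, Set.Ici_def] using Real.volume_Ici (a := 0)
  · simpa only [neg_one_mul, Left.nonneg_neg_iff, Set.Iic_def] using Real.volume_Iic (a := 0)

/-- For fixed `τ > 0` the fibre integral in `ω` diverges unless the amplitude vanishes. -/
lemma lintegral_exp_fibre_eq_top {n : ℕ} (hn : 0 < n) {z : ℂ} (hz : z ≠ 0) {ε τ : ℝ}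
    (hε : ε = 1 ∨ ε = -1) (hτ : 0 < τ) :
    ∫⁻ x : ℝ, ENNReal.ofReal (‖Real.exp (ε * x) • z‖ ^ 2 *
      (τ ^ ((n : ℤ) - 2) / (x ^ 2 + (1 + τ) ^ 2) ^ n)) = ⊤ := by
  have hz' : 0 < ‖z‖ := norm_pos_iff.mpr hz
  set c : ℝ := ‖z‖ ^ 2 * τ ^ ((n : ℤ) - 2) / (n ^ 2 + (1 + τ) ^ 2) ^ n with hc
  have hcpos : 0 < c := by positivity
  have hS : MeasurableSet {x : ℝ | 0 ≤ ε * x} :=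
    measurableSet_le measurable_const (measurable_const.mul measurable_id)
  refine top_le_iff.mp ?_
  calc (⊤ : ENNReal) = ∫⁻ _ in {x : ℝ | 0 ≤ ε * x}, ENNReal.ofReal c := by
        rw [setLIntegral_const, volume_setOf_nonneg_mul hε,
          ENNReal.mul_top (ENNReal.ofReal_pos.mpr hcpos).ne']
    _ ≤ ∫⁻ x in {x : ℝ | 0 ≤ ε * x}, ENNReal.ofReal (‖Real.exp (ε * x) • z‖ ^ 2 *
          (τ ^ ((n : ℤ) - 2) / (x ^ 2 + (1 + τ) ^ 2) ^ n)) := by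
        refine setLIntegral_mono' hS fun x hx => ENNReal.ofReal_le_ofReal ?_
        have key := sq_add_pow_le_mul_exp hn (sq_nonneg (1 + τ)) hx
        have hsq : (ε * x) ^ 2 = x ^ 2 := by rcases hε with rfl | rfl <;> ring
        rw [hsq] at key
        rw [norm_smul, Real.norm_of_nonneg (Real.exp_pos _).le, hc, ← mul_div_assoc,
          div_le_div_iff₀ (by positivity) (by positivity)]
        calc ‖z‖ ^ 2 * τ ^ ((n : ℤ) - 2) * (x ^ 2 + (1 + τ) ^ 2) ^ n
            ≤ ‖z‖ ^ 2 * τ ^ ((n : ℤ) - 2) *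
              ((n ^ 2 + (1 + τ) ^ 2) ^ n * Real.exp (ε * x) ^ 2) := by gcongr
          _ = _ := by ring
    _ ≤ _ := setLIntegral_le_lintegral _ _

/-- If ψ(ω, τ) = e^{εω}C(τ) (ε = ±1) is square-integrable with respect to
dμₙ = τ^{n−2}(ω² + (1+τ)²)^{−n} dω dτ on ℝ × (0,∞) for a positive integer n,
then C = 0 almost everywhere on (0,∞).  These ψ are exactly the formal
solutions of the deficiency equations (i ± Ĵ⁺)ψ = 0 for the Taub-NUT charge
operator Ĵ⁺ = i∂_ω, so both deficiency indices of Ĵ⁺ vanish. -/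
theorem deficiency_solutions_not_square_integrable
    (n : ℕ) (hn : 0 < n) (C : ℝ → ℂ) (hC : Measurable C)
    (ε : ℝ) (hε : ε = 1 ∨ ε = -1)
    (h : (∫⁻ p : ℝ × ℝ in Set.univ ×ˢ Set.Ioi (0 : ℝ),
        ENNReal.ofReal (‖Real.exp (ε * p.1) • C p.2‖ ^ 2 *
          (p.2 ^ ((n : ℤ) - 2) / (p.1 ^ 2 + (1 + p.2) ^ 2) ^ n))) < ⊤) :
    ∀ᵐ τ ∂(volume.restrict (Set.Ioi (0 : ℝ))), C τ = 0 := by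
  have hmeas : Measurable fun p : ℝ × ℝ => ENNReal.ofReal (‖Real.exp (ε * p.1) • C p.2‖ ^ 2 *
      (p.2 ^ ((n : ℤ) - 2) / (p.1 ^ 2 + (1 + p.2) ^ 2) ^ n)) := by
    have hpow : Measurable fun p : ℝ × ℝ => p.2 ^ ((n : ℤ) - 2) := measurable_snd.pow_const _
    have hnorm : Measurable fun p : ℝ × ℝ => ‖Real.exp (ε * p.1) • C p.2‖ :=
      ((Real.measurable_exp.comp (measurable_fst.const_mul ε)).smul
        (hC.comp measurable_snd)).norm
    exact ((hnorm.pow_const 2).mul (hpow.div (by fun_prop))).ennreal_ofReal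
  rw [Measure.volume_eq_prod, ← Measure.prod_restrict, Measure.restrict_univ,
    lintegral_prod_symm' _ hmeas] at h
  filter_upwards [ae_lt_top hmeas.lintegral_prod_left' h.ne,
    ae_restrict_mem measurableSet_Ioi] with τ hfin hτ
  by_contra hz
  exact hfin.ne (lintegral_exp_fibre_eq_top hn hz hε hτ)
end
end
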